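/- arXiv:1808.09475 — 2 statements merged into one kernel-verified Lean document; each statement's English description precedes it below -/
import Mathlib

section
/- If m, n ≥ 3 are integers with |m − n| ≥ 2, then the treewidth of the toroidal grid graph T_{m,n} equals 2·min{m, n}. -/
open SimpleGraph

/-- A tree decomposition of a graph `G`: a tree `tree` on node type `ι` with a bag of
vertices of `G` at each node, such that every vertex lies in some bag, both endpoints of
every edge lie in a common bag, and for each vertex the set of nodes whose bags contain it
induces a connected subgraph of the tree. -/
structure TreeDecomp {V : Type*} (G : SimpleGraph V) where
  ι : Type
  tree : SimpleGraph ι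
  isTree : tree.IsTree
  bag : ι → Set V
  bag_cover : ∀ v : V, ∃ t, v ∈ bag t
  bag_edge : ∀ ⦃u v : V⦄, G.Adj u v → ∃ t, u ∈ bag t ∧ v ∈ bag t
  bag_conn : ∀ v : V, (tree.induce {t | v ∈ bag t}).Connected

/-- The treewidth of `G`: the least `k` such that some tree decomposition of `G` has all
bags of size at most `k + 1` (i.e. the minimum over tree decompositions of one less than
the maximum bag size). -/
noncomputable def treewidth {V : Type*} (G : SimpleGraph V) : ℕ :=
  sInf {k : ℕ | ∃ D : TreeDecomp G, ∀ t, (D.bag t).ncard ≤ k + 1}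

/-- Two vertex sets touch if their union induces a connected subgraph. -/
def Touches {V : Type*} (G : SimpleGraph V) (A B : Set V) : Prop :=
  (G.induce (A ∪ B)).Connected

/-- A bramble: a family of vertex sets, each inducing a connected subgraph,
that pairwise touch. -/
structure IsBramble {V : Type*} (G : SimpleGraph V) (ℬ : Set (Set V)) : Prop where
  conn : ∀ B ∈ ℬ, (G.induce B).Connected
  touch : ∀ A ∈ ℬ, ∀ B ∈ ℬ, Touches G A B

/-- A strict bramble: a bramble any two of whose members share a vertex. -/
def IsStrictBramble {V : Type*} (G : SimpleGraph V) (ℬ : Set (Set V)) : Prop :=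
  IsBramble G ℬ ∧ ∀ A ∈ ℬ, ∀ B ∈ ℬ, (A ∩ B).Nonempty

/-- A hitting set for a family of vertex sets: a set meeting every member. -/
def IsHittingSet {V : Type*} (ℬ : Set (Set V)) (S : Set V) : Prop :=
  ∀ B ∈ ℬ, (S ∩ B).Nonempty

/-- The order of a bramble: the minimum size of a hitting set. -/
noncomputable def brambleOrder {V : Type*} (ℬ : Set (Set V)) : ℕ :=
  sInf {k : ℕ | ∃ S : Set V, IsHittingSet ℬ S ∧ S.ncard = k}

/-- The bramble number of `G`: the maximum order of a bramble on `G`. -/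
noncomputable def brambleNumber {V : Type*} (G : SimpleGraph V) : ℕ :=
  sSup {k : ℕ | ∃ ℬ, IsBramble G ℬ ∧ brambleOrder ℬ = k}

/-- The strict bramble number of `G`: the maximum order of a strict bramble on `G`. -/
noncomputable def strictBrambleNumber {V : Type*} (G : SimpleGraph V) : ℕ :=
  sSup {k : ℕ | ∃ ℬ, IsStrictBramble G ℬ ∧ brambleOrder ℬ = k}

/-- The `m × n` grid graph `P_m □ P_n`. -/
def gridGraph (m n : ℕ) : SimpleGraph (Fin m × Fin n) :=
  SimpleGraph.pathGraph m □ SimpleGraph.pathGraph n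

/-- The stacked prism graph `Y_{m,n} = C_m □ P_n`. -/
def stackedPrism (m n : ℕ) : SimpleGraph (Fin m × Fin n) :=
  SimpleGraph.cycleGraph m □ SimpleGraph.pathGraph n

/-- The toroidal grid graph `T_{m,n} = C_m □ C_n`. -/
def toroidalGrid (m n : ℕ) : SimpleGraph (Fin m × Fin n) :=
  SimpleGraph.cycleGraph m □ SimpleGraph.cycleGraph n

/-- `H` is a minor of `G`: there are pairwise disjoint nonempty connected branch sets in `G`,
one for each vertex of `H`, with an edge of `G` between the branch sets of any two vertices
adjacent in `H`. -/
def IsGraphMinor {W V : Type*} (H : SimpleGraph W) (G : SimpleGraph V) : Prop :=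
  ∃ B : W → Set V,
    (∀ w, (B w).Nonempty) ∧
    (∀ w, (G.induce (B w)).Connected) ∧
    (∀ w₁ w₂, w₁ ≠ w₂ → Disjoint (B w₁) (B w₂)) ∧
    (∀ ⦃w₁ w₂⦄, H.Adj w₁ w₂ → ∃ v₁ ∈ B w₁, ∃ v₂ ∈ B w₂, G.Adj v₁ v₂)

open Classical in
/-- The chip-firing move at a vertex `v`: `v` loses one chip along each incident edge,
each neighbor of `v` gains one chip. -/
noncomputable def fireVertex {V : Type*} (G : SimpleGraph V) (D : V → ℤ) (v : V) : V → ℤ :=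
  fun u => if u = v then D u - (G.neighborSet v).ncard
    else if G.Adj v u then D u + 1 else D u

/-- Two divisors on `G` are equivalent if one is obtained from the other by a finite
sequence of chip-firing moves. -/
def ChipEquiv {V : Type*} (G : SimpleGraph V) : (V → ℤ) → (V → ℤ) → Prop :=
  Relation.EqvGen (fun D D' => ∃ v, D' = fireVertex G D v)

/-- A divisor `D` wins the gonality game on `G` if for every vertex `q`, the divisor
`D - q` is equivalent to an effective divisor. -/
def WinsGonalityGame {V : Type*} [DecidableEq V] (G : SimpleGraph V) (D : V → ℤ) : Prop :=
  ∀ q : V, ∃ E : V → ℤ, (∀ v, 0 ≤ E v) ∧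
    ChipEquiv G (fun v => D v - if v = q then 1 else 0) E

/-- The divisorial gonality of `G`: the least degree of an effective divisor winning the
gonality game. -/
noncomputable def gonality {V : Type*} [Fintype V] [DecidableEq V] (G : SimpleGraph V) : ℕ :=
  sInf {k : ℕ | ∃ D : V → ℤ, (∀ v, 0 ≤ D v) ∧ (∑ v, D v) = (k : ℤ) ∧ WinsGonalityGame G D}

/-- `v` is reachable from `u` by a walk of `G` all of whose vertices after `u` lie in `A`. -/
def ReachIn {V : Type*} (G : SimpleGraph V) (A : Set V) : V → V → Prop :=
  Relation.ReflTransGen fun x y => G.Adj x y ∧ y ∈ A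

/-- Any two vertices of `A` are joined by a walk inside `A`. -/
def ConnIn {V : Type*} (G : SimpleGraph V) (A : Set V) : Prop :=
  ∀ u ∈ A, ∀ v ∈ A, ReachIn G A u v

section Reach

variable {V : Type*} {G : SimpleGraph V} {A B : Set V} {u v w : V}

theorem ReachIn.mono (h : ReachIn G A u v) (hAB : A ⊆ B) : ReachIn G B u v :=
  Relation.ReflTransGen.mono (fun _ _ h => ⟨h.1, hAB h.2⟩) _ _ h

theorem ReachIn.trans (h : ReachIn G A u v) (h' : ReachIn G A v w) : ReachIn G A u w :=
  Relation.ReflTransGen.trans h h'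

theorem ReachIn.mem (h : ReachIn G A u v) (hu : u ∈ A) : v ∈ A := by
  induction h with
  | refl => exact hu
  | tail _ h _ => exact h.2

theorem ReachIn.symm (h : ReachIn G A u v) (hu : u ∈ A) : ReachIn G A v u := by
  induction h with
  | refl => exact .refl
  | tail h₁ h₂ ih => exact Relation.ReflTransGen.head ⟨h₂.1.symm, ReachIn.mem h₁ hu⟩ ih

theorem ReachIn.exists_walk (h : ReachIn G A u v) (hu : u ∈ A) :
    ∃ p : G.Walk u v, ∀ x ∈ p.support, x ∈ A := by
  induction h with
  | refl => exact ⟨.nil, by simpa using hu⟩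
  | tail _ h ih =>
    obtain ⟨p, hp⟩ := ih
    refine ⟨p.concat h.1, fun x hx => ?_⟩
    rw [Walk.support_concat, List.mem_append, List.mem_singleton] at hx
    rcases hx with hx | rfl
    exacts [hp x hx, h.2]

theorem connIn_of_induce (h : (G.induce A).Preconnected) : ConnIn G A := by
  intro u hu v hv
  obtain ⟨p⟩ := h ⟨u, hu⟩ ⟨v, hv⟩
  have key : ∀ (x y : A) (_ : (G.induce A).Walk x y), ReachIn G A x y := by
    intro x y p
    induction p with
    | nil => exact .refl
    | @cons a b c hab _ ih => exact Relation.ReflTransGen.head ⟨hab, b.2⟩ ih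
  exact key _ _ p

end Reach

section Tree

variable {ι : Type*} {T : SimpleGraph ι}

/-- In a tree, let `g` be a vertex of a connected set `A` closest to the root `r`. Then the path
from `r` to any `x ∈ A` splits at `g` into a shortest walk and a walk inside `A`. -/
theorem exists_path_through_gate (hT : T.Connected) {A : Set ι} (hA : ConnIn T A) {r g x : ι}
    (hg : g ∈ A) (hmin : ∀ y ∈ A, T.dist r g ≤ T.dist r y) (hx : x ∈ A) :
    ∃ (q : T.Walk r g) (p : T.Walk g x), q.length = T.dist r g ∧ (∀ y ∈ p.support, y ∈ A) ∧
      (q.append p).IsPath := by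
  classical
  obtain ⟨q, hq, hql⟩ := hT.exists_path_of_dist r g
  obtain ⟨p', hp'⟩ := (hA g hg x hx).exists_walk hg
  have hsub : ∀ y ∈ p'.bypass.support, y ∈ A := fun y hy =>
    hp' y (p'.support_bypass_subset_support hy)
  refine ⟨q, p'.bypass, hql, hsub, ?_⟩
  have hp := p'.bypass_isPath
  rw [Walk.isPath_def, Walk.support_append, List.nodup_append]
  have hnd := hp.support_nodup
  rw [← Walk.cons_tail_support, List.nodup_cons] at hnd
  refine ⟨hq.support_nodup, hnd.2, ?_⟩
  rintro y hy z hz rfl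
  have hyA : y ∈ A := hsub y (List.mem_of_mem_tail hz)
  by_cases hyg : y = g
  · exact hnd.1 (hyg ▸ hz)
  · have h1 := hmin y hyA
    have h2 := T.dist_le (q.takeUntil y hy)
    have h3 := q.length_takeUntil_lt_length hy hyg
    omega

/-- Helly property of subtrees of a tree. -/
theorem helly_of_isTree (hT : T.IsTree) {α : Type*} [Finite α] [Nonempty α] (A : α → Set ι)
    (hconn : ∀ a, ConnIn T (A a)) (hpair : ∀ a b, (A a ∩ A b).Nonempty) :
    ∃ t, ∀ a, t ∈ A a := by
  classical
  obtain ⟨r⟩ := hT.1.nonempty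
  have hgate : ∀ a, ∃ g ∈ A a, ∀ y ∈ A a, T.dist r g ≤ T.dist r y := fun a =>
    exists_minimalFor_of_wellFoundedLT (· ∈ A a) (T.dist r) ((hpair a a).mono (by simp))
      |>.imp fun g hg => ⟨hg.1, fun y hy => by
        by_contra! h
        exact absurd (hg.2 hy h.le) (not_le.2 h)⟩
  choose g hg hmin using hgate
  obtain ⟨a, ha⟩ := Finite.exists_max fun a => T.dist r (g a)
  refine ⟨g a, fun b => ?_⟩
  obtain ⟨x, hxa, hxb⟩ := hpair a b
  obtain ⟨q, p, hq, hp, hqp⟩ := exists_path_through_gate hT.1 (hconn a) (hg a) (hmin a) hxa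
  obtain ⟨q', p', hq', hp', hqp'⟩ := exists_path_through_gate hT.1 (hconn b) (hg b) (hmin b) hxb
  have hEq := (hT.2.subsingleton_path _ _).elim ⟨_, hqp⟩ ⟨_, hqp'⟩
  have hEq' : q.append p = q'.append p' := congrArg Subtype.val hEq
  have hmem : g a ∈ (q'.append p').support := by
    rw [← hEq']; simp
  rw [Walk.mem_support_append_iff] at hmem
  rcases hmem with hmem | hmem
  · by_cases hab : g a = g b
    · exact hab ▸ hg b
    · have h1 := ha b
      have h2 := T.dist_le (q'.takeUntil _ hmem)
      have h3 := q'.length_takeUntil_lt_length hmem hab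
      omega
  · exact hp' _ hmem

end Tree

section TreeDecomposition

variable {V : Type*} {G : SimpleGraph V}

theorem TreeDecomp.connIn_nodes (D : TreeDecomp G) {B : Set V} (hB : ConnIn G B) :
    ConnIn D.tree {t | ∃ b ∈ B, b ∈ D.bag t} := by
  rintro s ⟨b, hb, hbs⟩ t ⟨c, hc, hct⟩
  have key : ∀ c, ReachIn G B b c → ∀ t, c ∈ D.bag t →
      ReachIn D.tree {t | ∃ b ∈ B, b ∈ D.bag t} s t := by
    have sub : ∀ c ∈ B, ∀ s t, c ∈ D.bag s → c ∈ D.bag t →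
        ReachIn D.tree {t | ∃ b ∈ B, b ∈ D.bag t} s t := fun c hc s t hs ht =>
      (connIn_of_induce (D.bag_conn c).1 s hs t ht).mono fun t ht => ⟨c, hc, ht⟩
    intro c h
    induction h with
    | refl => exact fun t ht => sub b hb s t hbs ht
    | tail _ h ih =>
      intro t ht
      obtain ⟨u, hu, hu'⟩ := D.bag_edge h.1
      exact (ih u hu).trans (sub _ h.2 u t hu' ht)
  exact key c (hB b hb c hc) t hct

/-- Finitely many connected sets, any two of which share a vertex or are joined by an edge, are
simultaneously met by some bag. -/
theorem TreeDecomp.exists_bag_meeting (D : TreeDecomp G) {α : Type*} [Finite α] [Nonempty α]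
    (B : α → Set V) (hconn : ∀ a, ConnIn G (B a))
    (htouch : ∀ a b, ∃ u ∈ B a, ∃ v ∈ B b, u = v ∨ G.Adj u v) :
    ∃ t, ∀ a, ∃ v ∈ B a, v ∈ D.bag t := by
  refine helly_of_isTree D.isTree (fun a => {t | ∃ v ∈ B a, v ∈ D.bag t})
    (fun a => D.connIn_nodes (hconn a)) fun a b => ?_
  obtain ⟨u, hu, v, hv, rfl | h⟩ := htouch a b
  · obtain ⟨t, ht⟩ := D.bag_cover u
    exact ⟨t, ⟨u, hu, ht⟩, ⟨u, hv, ht⟩⟩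
  · obtain ⟨t, ht, ht'⟩ := D.bag_edge h
    exact ⟨t, ⟨u, hu, ht⟩, ⟨v, hv, ht'⟩⟩

/-- If every vertex of a bag has a neighbour in a nonempty connected set `C`, then some bag contains
that bag together with a vertex of `C`. -/
theorem TreeDecomp.exists_bag_superset [Finite V] (D : TreeDecomp G) {t : D.ι} {C : Set V}
    (hC : ConnIn G C) (hne : C.Nonempty)
    (hnbr : ∀ s ∈ D.bag t, ∃ c ∈ C, G.Adj c s) :
    ∃ w, D.bag t ⊆ D.bag w ∧ ∃ c ∈ C, c ∈ D.bag w := by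
  obtain ⟨w, hw⟩ := helly_of_isTree D.isTree
    (fun o : Option (D.bag t) => o.elim {w | ∃ c ∈ C, c ∈ D.bag w} fun s => {w | s.1 ∈ D.bag w})
    (by
      rintro (_ | s)
      · exact D.connIn_nodes hC
      · exact connIn_of_induce (D.bag_conn s.1).1)
    (by
      have hCs : ∀ s ∈ D.bag t, ∃ w, s ∈ D.bag w ∧ ∃ c ∈ C, c ∈ D.bag w := by
        intro s hs
        obtain ⟨c, hc, hcs⟩ := hnbr s hs
        obtain ⟨w, hw, hw'⟩ := D.bag_edge hcs
        exact ⟨w, hw', c, hc, hw⟩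
      rintro (_ | s) (_ | s')
      · obtain ⟨c, hc⟩ := hne
        obtain ⟨w, hw⟩ := D.bag_cover c
        exact ⟨w, ⟨c, hc, hw⟩, ⟨c, hc, hw⟩⟩
      · obtain ⟨w, h1, h2⟩ := hCs s' s'.2
        exact ⟨w, h2, h1⟩
      · obtain ⟨w, h1, h2⟩ := hCs s s.2
        exact ⟨w, h1, h2⟩
      · exact ⟨t, s.2, s'.2⟩)
  exact ⟨w, fun s hs => hw (some ⟨s, hs⟩), hw none⟩

end TreeDecomposition

section Cycle

variable {V : Type*} {G : SimpleGraph V} {k : ℕ} [NeZero k] {f : Fin k → V} {A : Set V}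

/-- Travelling around a cycle from `x` to `y` without passing the base point `p`. -/
theorem reachIn_cyclic_arc (hf : ∀ z, G.Adj (f z) (f (z + 1))) (p x : Fin k) (d : ℕ) :
    ∀ y : Fin k, (y - p).val = (x - p).val + d →
      (∀ z : Fin k, (x - p).val ≤ (z - p).val → (z - p).val ≤ (y - p).val → f z ∈ A) →
      ReachIn G A (f x) (f y) := by
  induction d with
  | zero =>
    intro y hy _
    have : y - p = x - p := Fin.ext (by simpa using hy)
    rw [sub_left_injective this]
    exact .refl
  | succ d ih =>
    intro y hy hA
    have hne : y - p ≠ 0 := fun h => by simp [h] at hy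
    have hval : (y - 1 - p).val = (y - p).val - 1 := by
      rw [sub_right_comm]
      exact Fin.val_sub_one_of_ne_zero hne
    have h1 := ih (y - 1) (by omega) fun z hz hz' => hA z hz (by omega)
    have h2 := hf (y - 1)
    rw [sub_add_cancel] at h2
    exact Relation.ReflTransGen.tail h1 ⟨h2, hA y (by omega) le_rfl⟩

theorem reachIn_cyclic_between (hf : ∀ z, G.Adj (f z) (f (z + 1))) (p : Fin k) {x y : Fin k}
    (hA : ∀ z : Fin k, min (x - p).val (y - p).val ≤ (z - p).val →
      (z - p).val ≤ max (x - p).val (y - p).val → f z ∈ A) :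
    ReachIn G A (f x) (f y) := by
  rcases le_total (x - p).val (y - p).val with h | h
  · rw [min_eq_left h, max_eq_right h] at hA
    exact reachIn_cyclic_arc hf p x _ y (Nat.add_sub_of_le h).symm hA
  · rw [min_eq_right h, max_eq_left h] at hA
    exact (reachIn_cyclic_arc hf p y _ x (Nat.add_sub_of_le h).symm hA).symm (hA y le_rfl h)

theorem val_sub_eq_iff {x y p : Fin k} : (x - p).val = (y - p).val ↔ x = y := by
  rw [← Fin.ext_iff, sub_left_inj]

/-- A cycle minus at most one vertex is connected. -/
theorem reachIn_cyclic_of_subsingleton (hf : ∀ z, G.Adj (f z) (f (z + 1)))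
    (hA : {z | f z ∉ A}.Subsingleton) {x y : Fin k} (hx : f x ∈ A) (hy : f y ∈ A) :
    ReachIn G A (f x) (f y) := by
  by_cases hp : ∃ p, f p ∉ A
  · obtain ⟨p, hp⟩ := hp
    refine reachIn_cyclic_between hf p fun z hz _ => ?_
    by_contra hzA
    obtain rfl : z = p := hA hzA hp
    have hxz : x ≠ z := fun h => hzA (h ▸ hx)
    have hyz : y ≠ z := fun h => hzA (h ▸ hy)
    have := (val_sub_eq_iff (p := z)).not.2 hxz
    have := (val_sub_eq_iff (p := z)).not.2 hyz
    simp only [sub_self, Fin.val_zero] at *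
    omega
  · push Not at hp
    exact reachIn_cyclic_between hf x fun z _ _ => hp z

/-- A cycle minus two vertices `a`, `b` has at most two connected pieces. -/
theorem reachIn_cyclic_of_pair (hf : ∀ z, G.Adj (f z) (f (z + 1))) {a b : Fin k}
    (hA : ∀ z, z ≠ a → z ≠ b → f z ∈ A) {x y : Fin k} (hxa : x ≠ a) (hxb : x ≠ b)
    (hya : y ≠ a) (hyb : y ≠ b) (hxy : (x - a).val < (b - a).val ↔ (y - a).val < (b - a).val) :
    ReachIn G A (f x) (f y) := by
  refine reachIn_cyclic_between hf a fun z hz hz' => hA z ?_ ?_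
  · rintro rfl
    have := (val_sub_eq_iff (p := z)).not.2 hxa
    have := (val_sub_eq_iff (p := z)).not.2 hya
    simp only [sub_self, Fin.val_zero] at *
    omega
  · rintro rfl
    have := (val_sub_eq_iff (p := a)).not.2 hxb
    have := (val_sub_eq_iff (p := a)).not.2 hyb
    omega

end Cycle

section Torus

theorem cycleGraph_adj_add_one {k : ℕ} [NeZero k] (hk : 2 ≤ k) (z : Fin k) :
    (cycleGraph k).Adj z (z + 1) := by
  obtain ⟨k, rfl⟩ := Nat.exists_eq_add_of_le' hk
  simp [cycleGraph_adj]

theorem toroidalGrid_adj_snd {m n : ℕ} [NeZero n] (hn : 2 ≤ n) (i : Fin m) (j : Fin n) :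
    (toroidalGrid m n).Adj (i, j) (i, j + 1) := by
  simp [toroidalGrid, boxProd_adj, cycleGraph_adj_add_one hn]

theorem toroidalGrid_adj_fst {m n : ℕ} [NeZero m] (hm : 2 ≤ m) (i : Fin m) (j : Fin n) :
    (toroidalGrid m n).Adj (i, j) (i + 1, j) := by
  simp [toroidalGrid, boxProd_adj, cycleGraph_adj_add_one hm]

variable {m n : ℕ}

/-- A set of at most `2 * m` vertices misses some column, or meets at least four columns exactly
once. -/
theorem exists_column_or_four_le (hmn : m + 2 ≤ n) (X : Set (Fin m × Fin n))
    (hX : X.ncard ≤ 2 * m) :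
    (∃ j, ∀ i, (i, j) ∉ X) ∨
      ∃ J : Finset (Fin n), 4 ≤ J.card ∧ ∀ j ∈ J, ∃ i, ∀ i', (i', j) ∈ X ↔ i' = i := by
  classical
  by_cases h0 : ∃ j, ∀ i, (i, j) ∉ X
  · exact .inl h0
  push Not at h0
  let c : Fin n → Finset (Fin m) := fun j => {i | (i, j) ∈ X}
  have hc : X.ncard = ∑ j, (c j).card := by
    rw [Set.ncard_eq_toFinset_card' X, Finset.card_eq_sum_card_fiberwise (f := Prod.snd)
      (t := Finset.univ) (fun _ _ => Finset.mem_coe.2 (Finset.mem_univ _))]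
    refine Finset.sum_congr rfl fun j _ => ?_
    refine Finset.card_nbij' Prod.fst (fun i => (i, j)) ?_ ?_ ?_ ?_ <;>
      simp +contextual [c, Set.MapsTo, Set.LeftInvOn, Prod.ext_iff]
    rintro i _ h rfl
    exact h
  refine .inr ⟨Finset.univ.filter fun j => (c j).card = 1, ?_, fun j hj => ?_⟩
  · have h1 : ∀ j, 2 ≤ (c j).card + if (c j).card = 1 then 1 else 0 := by
      intro j
      obtain ⟨i, hi⟩ := h0 j
      have : 0 < (c j).card := Finset.card_pos.2 ⟨i, by simpa [c] using hi⟩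
      split_ifs <;> omega
    have h2 := Finset.sum_le_sum fun j (_ : j ∈ Finset.univ) => h1 j
    rw [Finset.sum_add_distrib, ← hc, ← Finset.card_filter] at h2
    simp at h2
    omega
  · obtain ⟨i, hi⟩ := Finset.card_eq_one.1 (Finset.mem_filter.1 hj).2
    exact ⟨i, fun i' => by simpa [c] using Finset.ext_iff.1 hi i'⟩

/-- If `X` has at most `2 * m` vertices and meets every row at least twice, then it meets every row
exactly twice. -/
theorem exists_pair_of_not_subsingleton (X : Set (Fin m × Fin n)) (hX : X.ncard ≤ 2 * m)
    (hrow : ∀ i, ¬ {j | (i, j) ∈ X}.Subsingleton) :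
    X.ncard = 2 * m ∧ ∀ i, ∃ x y, x ≠ y ∧ ∀ j, (i, j) ∈ X ↔ j = x ∨ j = y := by
  classical
  let c : Fin m → Finset (Fin n) := fun i => {j | (i, j) ∈ X}
  have hc : X.ncard = ∑ i, (c i).card := by
    rw [Set.ncard_eq_toFinset_card' X, Finset.card_eq_sum_card_fiberwise (f := Prod.fst)
      (t := Finset.univ) (fun _ _ => Finset.mem_coe.2 (Finset.mem_univ _))]
    refine Finset.sum_congr rfl fun i _ => ?_
    refine Finset.card_nbij' Prod.snd (fun j => (i, j)) ?_ ?_ ?_ ?_ <;>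
      simp +contextual [c, Set.MapsTo, Set.LeftInvOn, Prod.ext_iff]
    rintro _ j h rfl
    exact h
  have h2 : ∀ i ∈ Finset.univ, 2 ≤ (c i).card := by
    intro i _
    obtain ⟨x, hx, y, hy, hxy⟩ := Set.not_subsingleton_iff.1 (hrow i)
    exact Finset.one_lt_card.2 ⟨x, by simpa [c] using hx, y, by simpa [c] using hy, hxy⟩
  have hle := Finset.sum_le_sum h2
  have hsum : ∑ _i : Fin m, 2 = 2 * m := by simp [mul_comm]
  refine ⟨by omega, fun i => ?_⟩
  have heq := (Finset.sum_eq_sum_iff_of_le h2).1 (by omega) i (Finset.mem_univ i)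
  obtain ⟨x, y, hxy, h⟩ := Finset.card_eq_two.1 heq.symm
  exact ⟨x, y, hxy, fun j => by simpa [c] using Finset.ext_iff.1 h j⟩

/-- The part of row `i` outside `X`, together with the parts outside `X` of those columns that meet
`X` at most once and cross row `i` outside `X`. -/
def rowComb (X : Set (Fin m × Fin n)) (i : Fin m) : Set (Fin m × Fin n) :=
  {v | v ∉ X ∧ (v.1 = i ∨ {k | (k, v.2) ∈ X}.Subsingleton ∧ (i, v.2) ∉ X)}

variable [NeZero m] [NeZero n]

theorem connIn_rowComb (hm : 2 ≤ m) (hn : 2 ≤ n) {X : Set (Fin m × Fin n)} {i : Fin m}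
    (hrow : {j | (i, j) ∈ X}.Subsingleton) : ConnIn (toroidalGrid m n) (rowComb X i) := by
  have hcol : ∀ v ∈ rowComb X i, (i, v.2) ∈ rowComb X i ∧
      ReachIn (toroidalGrid m n) (rowComb X i) v (i, v.2) := by
    rintro ⟨k, j⟩ ⟨hv, rfl | ⟨hs, hj⟩⟩
    · exact ⟨⟨hv, .inl rfl⟩, .refl⟩
    · refine ⟨⟨hj, .inl rfl⟩, ?_⟩
      refine reachIn_cyclic_of_subsingleton (f := fun z => (z, j))
        (fun z => toroidalGrid_adj_fst hm z j) (hs.anti fun z hz => ?_) ⟨hv, .inr ⟨hs, hj⟩⟩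
        ⟨hj, .inl rfl⟩
      by_contra hzX
      exact hz ⟨hzX, .inr ⟨hs, hj⟩⟩
  intro u hu v hv
  obtain ⟨hu1, hu2⟩ := hcol u hu
  obtain ⟨hv1, hv2⟩ := hcol v hv
  refine (hu2.trans ?_).trans (hv2.symm hv)
  refine reachIn_cyclic_of_subsingleton (f := fun z => (i, z))
    (fun z => toroidalGrid_adj_snd hn i z) (hrow.anti fun z hz => ?_) hu1 hv1
  by_contra hzX
  exact hz ⟨hzX, .inl rfl⟩

theorem rowComb_touch (hm : 2 ≤ m) (hmn : m + 2 ≤ n) {X X' : Set (Fin m × Fin n)} {i i' : Fin m}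
    (hrow : {j | (i, j) ∈ X}.Subsingleton) (hX' : X'.ncard ≤ 2 * m)
    (hrow' : {j | (i', j) ∈ X'}.Subsingleton) :
    ∃ u ∈ rowComb X i, ∃ v ∈ rowComb X' i', u = v ∨ (toroidalGrid m n).Adj u v := by
  classical
  have key : ∃ j, {k | (k, j) ∈ X'}.Subsingleton ∧ (i', j) ∉ X' ∧
      ((i, j) ∉ X' ∨ (i, j) ∉ X) := by
    obtain ⟨j, hj⟩ | ⟨J, hJ, hJ'⟩ := exists_column_or_four_le hmn X' hX'
    · exact ⟨j, fun k hk => absurd hk (hj k), hj i', .inl (hj i)⟩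
    · let F : Finset (Fin n) := {j | (i, j) ∈ X}
      let F' : Finset (Fin n) := {j | (i', j) ∈ X'}
      have hF : F.card ≤ 1 := Finset.card_le_one.2 fun a ha b hb =>
        hrow (by simpa [F] using ha) (by simpa [F] using hb)
      have hF' : F'.card ≤ 1 := Finset.card_le_one.2 fun a ha b hb =>
        hrow' (by simpa [F'] using ha) (by simpa [F'] using hb)
      have hU := Finset.card_union_le F F'
      obtain ⟨j, hj, hjF⟩ := Finset.exists_mem_notMem_of_card_lt_card
        (show (F ∪ F').card < J.card by omega)
      simp only [F, F', Finset.mem_union, Finset.mem_filter, Finset.mem_univ, true_and,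
        not_or] at hjF
      obtain ⟨k, hk⟩ := hJ' j hj
      refine ⟨j, fun a ha b hb => ?_, hjF.2, .inr hjF.1⟩
      rw [(hk a).1 ha, (hk b).1 hb]
  obtain ⟨j, hs, hj', hj⟩ := key
  by_cases hX : (i, j) ∈ X
  · have hjX' := hj.resolve_right (not_not.2 hX)
    have hadj := toroidalGrid_adj_snd (by omega) i j
    refine ⟨(i, j + 1), ⟨fun h => ?_, .inl rfl⟩, (i, j), ⟨hjX', .inr ⟨hs, hj'⟩⟩, .inr hadj.symm⟩
    exact hadj.ne (Prod.ext rfl (hrow hX h))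
  · by_cases hX2 : (i, j) ∈ X'
    · have hadj := toroidalGrid_adj_fst hm i j
      refine ⟨(i, j), ⟨hX, .inl rfl⟩, (i + 1, j), ⟨fun h => ?_, .inr ⟨hs, hj'⟩⟩, .inr hadj⟩
      exact hadj.ne (Prod.ext (hs hX2 h) rfl)
    · exact ⟨(i, j), ⟨hX, .inl rfl⟩, (i, j), ⟨hX2, .inr ⟨hs, hj'⟩⟩, .inl rfl⟩

end Torus

section LowerBound

/-- Four columns with one marked row each leave three of them unmarked in some row, as there are at
least three rows. -/
theorem exists_row_three_ne {m n : ℕ} (hm : 3 ≤ m) {J : Finset (Fin n)} (hJ : 4 ≤ J.card)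
    (h : Fin n → Fin m) : ∃ (i : Fin m), ∃ x ∈ J, ∃ y ∈ J, ∃ z ∈ J, x ≠ y ∧ x ≠ z ∧ y ≠ z ∧
      h x ≠ i ∧ h y ≠ i ∧ h z ≠ i := by
  classical
  obtain ⟨K, hKJ, hK⟩ := Finset.exists_subset_card_eq hJ
  have hex : ∃ i, (K.filter fun j => h j = i).card ≤ 1 := by
    by_contra! hcon
    have h1 := Finset.card_eq_sum_card_fiberwise (f := h) (s := K) (t := Finset.univ)
      fun _ _ => Finset.mem_coe.2 (Finset.mem_univ _)
    have h2 := Finset.sum_le_sum fun i (_ : i ∈ Finset.univ) => Nat.succ_le_of_lt (hcon i)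
    simp at h2
    omega
  obtain ⟨i, hi⟩ := hex
  have hsplit := Finset.card_filter_add_card_filter_not (s := K) fun j => h j = i
  obtain ⟨x, y, z, hx, hy, hz, h1, h2, h3⟩ :=
    Finset.two_lt_card_iff.1 (show 2 < (K.filter fun j => ¬ h j = i).card by omega)
  simp only [Finset.mem_filter] at hx hy hz
  exact ⟨i, x, hKJ hx.1, y, hKJ hy.1, z, hKJ hz.1, h1, h2, h3, hx.2, hy.2, hz.2⟩

variable {m n : ℕ} [NeZero m] [NeZero n]

/-- Each piece left by `S` misses the whole row of some vertex of `S` not adjacent to it, provided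
`S` is a bag of maximal size that meets all the row combs. -/
theorem exists_row_missed {D : TreeDecomp (toroidalGrid m n)} (hm : 2 ≤ m) (hn : 2 ≤ n)
    (hD : ∀ t, (D.bag t).ncard ≤ 2 * m) {t : D.ι}
    (ht : ∀ X i, X.ncard ≤ 2 * m → {j | (i, j) ∈ X}.Subsingleton → ∃ v ∈ rowComb X i, v ∈ D.bag t)
    (hcard : (D.bag t).ncard = 2 * m)
    (hpair : ∀ i, ∃ x y, x ≠ y ∧ ∀ j, (i, j) ∈ D.bag t ↔ j = x ∨ j = y)
    {u : Fin m × Fin n} (hu : u ∉ D.bag t) :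
    ∃ s ∈ D.bag t, (∀ c, ReachIn (toroidalGrid m n) (D.bag t)ᶜ u c →
      ¬ (toroidalGrid m n).Adj c s ∧ c.1 ≠ s.1) := by
  let G := toroidalGrid m n
  set S := D.bag t with hS
  let C : Set (Fin m × Fin n) := {c | ReachIn G Sᶜ u c}
  have hCS : ∀ c ∈ C, c ∉ S := fun c hc => ReachIn.mem (A := Sᶜ) hc hu
  have hCconn : ConnIn G C := by
    have key : ∀ c, ReachIn G Sᶜ u c → ReachIn G C u c := by
      intro c hc
      induction hc with
      | refl => exact .refl
      | tail h₁ h₂ ih => exact ih.tail ⟨h₂.1, h₁.tail h₂⟩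
    intro a ha b hb
    exact ((key a ha).symm Relation.ReflTransGen.refl).trans (key b hb)
  have hex : ∃ s ∈ S, ∀ c ∈ C, ¬ G.Adj c s := by
    by_contra! hcon
    obtain ⟨w, hw, c, hc, hcw⟩ := D.exists_bag_superset hCconn ⟨u, .refl⟩ hcon
    have hlt : S.ncard < (D.bag w).ncard :=
      Set.ncard_lt_ncard ⟨hw, fun h => hCS c hc (h hcw)⟩ (Set.toFinite _)
    have := hD w
    omega
  obtain ⟨s, hs, hsC⟩ := hex
  refine ⟨s, hs, fun c hc => ⟨hsC c hc, fun hcs => ?_⟩⟩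
  let X : Set (Fin m × Fin n) := {v | v ∈ S ∧ ∃ c ∈ C, G.Adj c v}
  have hXcard : X.ncard ≤ 2 * m :=
    hcard ▸ Set.ncard_le_ncard (fun v hv => hv.1) (Set.toFinite _)
  have hsX : s ∉ X := fun ⟨_, c, hc, h⟩ => hsC c hc h
  have hrow : {j | (s.1, j) ∈ X}.Subsingleton := by
    obtain ⟨x, y, -, hxy⟩ := hpair s.1
    have hs2 := (hxy s.2).1 hs
    intro a ha b hb
    have ha' := (hxy a).1 ha.1
    have hb' := (hxy b).1 hb.1
    have has : a ≠ s.2 := fun h => hsX (by rw [h] at ha; exact ha)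
    have hbs : b ≠ s.2 := fun h => hsX (by rw [h] at hb; exact hb)
    grind
  have hcX : c ∈ rowComb X s.1 := ⟨fun h => hCS c hc h.1, .inl hcs⟩
  have hsub : ∀ v, ReachIn G (rowComb X s.1) c v → v ∈ C := by
    intro v hv
    induction hv with
    | refl => exact hc
    | @tail a b _ h ih =>
      exact Relation.ReflTransGen.tail ih ⟨h.1, fun hb => h.2.1 ⟨hb, a, ih, h.1⟩⟩
  obtain ⟨v, hv, hvS⟩ := ht X s.1 hXcard hrow
  exact hCS v (hsub v (connIn_rowComb hm hn hrow c hcX v hv)) hvS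

/-- For `m + 2 ≤ n`, every tree decomposition of the torus has a bag of more than `2 * m`
vertices. -/
theorem exists_bag_ncard_gt (hm : 3 ≤ m) (hmn : m + 2 ≤ n) (D : TreeDecomp (toroidalGrid m n)) :
    ∃ t, 2 * m < (D.bag t).ncard := by
  by_contra! hD
  let G := toroidalGrid m n
  have hm2 : 2 ≤ m := by omega
  have hn2 : 2 ≤ n := by omega
  obtain ⟨t, ht⟩ : ∃ t, ∀ X i, X.ncard ≤ 2 * m → {j | (i, j) ∈ X}.Subsingleton →
      ∃ v ∈ rowComb X i, v ∈ D.bag t := by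
    let α := {p : Set (Fin m × Fin n) × Fin m //
      p.1.ncard ≤ 2 * m ∧ {j | (p.2, j) ∈ p.1}.Subsingleton}
    have : Nonempty α := ⟨⟨(∅, 0), by simp, by simp⟩⟩
    obtain ⟨t, ht⟩ := D.exists_bag_meeting (fun p : α => rowComb p.1.1 p.1.2)
      (fun p => connIn_rowComb hm2 hn2 p.2.2)
      fun p q => rowComb_touch hm2 hmn p.2.2 q.2.1 q.2.2
    exact ⟨t, fun X i h h' => ht ⟨(X, i), h, h'⟩⟩
  have hrow : ∀ i, ¬ {j | (i, j) ∈ D.bag t}.Subsingleton := fun i hi => by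
    obtain ⟨v, hv, hvt⟩ := ht (D.bag t) i (hD t) hi
    exact hv.1 hvt
  obtain ⟨hcard, hpair⟩ := exists_pair_of_not_subsingleton (D.bag t) (hD t) hrow
  have hmiss : ∀ u, u ∉ D.bag t → _ := fun u hu => exists_row_missed hm2 hn2 hD ht hcard hpair hu
  set S := D.bag t
  have hcol : ∀ j, {k | (k, j) ∈ S}.Subsingleton → ∀ a b, (a, j) ∉ S → (b, j) ∉ S →
      ReachIn G Sᶜ (a, j) (b, j) := fun j hj a b ha hb =>
    reachIn_cyclic_of_subsingleton (A := Sᶜ) (f := fun z => (z, j))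
      (fun z => toroidalGrid_adj_fst hm2 z j) (hj.anti fun z hz => not_not.1 hz) ha hb
  obtain ⟨j, hj⟩ | ⟨J, hJ, hJS⟩ := exists_column_or_four_le hmn S (hD t)
  · obtain ⟨s, -, hs⟩ := hmiss (0, j) (hj 0)
    exact (hs (s.1, j) (hcol j (fun k hk => absurd hk (hj k)) _ _ (hj _) (hj _))).2 rfl
  · have hJS' : ∀ j, ∃ i, j ∈ J → ∀ i', (i', j) ∈ S ↔ i' = i := by
      intro j
      by_cases hj : j ∈ J
      · exact (hJS j hj).imp fun i hi _ => hi
      · exact ⟨0, fun h => absurd h hj⟩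
    choose h hh using hJS'
    -- A column meeting `S` only at `(h j, j)` lies in a piece missing row `h j`; this piece meets
    -- the next row only in column `j`.
    have hpiece : ∀ j ∈ J, ∀ i, i ≠ h j → ∀ c, ReachIn G Sᶜ (i, j) c →
        c.1 ≠ h j ∧ (c.1 = h j + 1 → c.2 = j) := by
      intro j hj i hi
      have hiS : (i, j) ∉ S := fun hc => hi ((hh j hj i).1 hc)
      have hsub : {k | (k, j) ∈ S}.Subsingleton := fun a ha b hb => by
        rw [(hh j hj a).1 ha, (hh j hj b).1 hb]
      obtain ⟨s, hs, hsC⟩ := hmiss (i, j) hiS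
      have hs1 : s.1 = h j := by
        by_contra hne
        have hnS : (s.1, j) ∉ S := fun hc => hne ((hh j hj _).1 hc)
        exact (hsC (s.1, j) (hcol j hsub _ _ hiS hnS)).2 rfl
      have hadj := toroidalGrid_adj_fst (n := n) hm2
      have hs2 : s.2 ≠ j := by
        intro hsj
        have hnS : (h j + 1, j) ∉ S := fun hc =>
          (hadj (h j) j).ne (Prod.ext ((hh j hj _).1 hc).symm rfl)
        refine (hsC (h j + 1, j) (hcol j hsub _ _ hiS hnS)).1 ?_
        rw [show s = (h j, j) from Prod.ext hs1 hsj]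
        exact (hadj (h j) j).symm
      refine fun c hc => ⟨hs1 ▸ (hsC c hc).2, fun hc1 => ?_⟩
      have hc' : (h j + 1, c.2) = c := Prod.ext hc1.symm rfl
      have hcadj := (hadj (h j) c.2).symm
      rw [hc'] at hcadj
      have hcS : (h j, c.2) ∈ S := by
        by_contra hnS
        exact (hsC (h j, c.2) (hc.tail ⟨hcadj, hnS⟩)).2 hs1.symm
      obtain ⟨x, y, -, hxy⟩ := hpair (h j)
      have e1 := (hxy c.2).1 hcS
      have e2 := (hxy s.2).1 (hs1 ▸ hs)
      have e3 := (hxy j).1 ((hh j hj _).2 rfl)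
      have e4 : c.2 ≠ s.2 := fun e => (hsC c hc).1 (by
        rw [show s = (h j, c.2) from Prod.ext hs1 e.symm]
        exact hcadj)
      grind
    have hsep : ∀ j ∈ J, ∀ j' ∈ J, ∀ i, i ≠ h j → i ≠ h j' →
        ReachIn G Sᶜ (i, j) (i, j') → j = j' := by
      intro j hj j' hj' i hi hi' hr
      have hsub : {k | (k, j') ∈ S}.Subsingleton := fun a ha b hb => by
        rw [(hh j' hj' a).1 ha, (hh j' hj' b).1 hb]
      have hr' : ∀ a, a ≠ h j' → ReachIn G Sᶜ (i, j) (a, j') := fun a ha =>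
        hr.trans (hcol j' hsub _ _ (fun hc => hi' ((hh j' hj' _).1 hc))
          fun hc => ha ((hh j' hj' _).1 hc))
      have hEq : h j = h j' := by
        by_contra hne
        exact (hpiece j hj i hi _ (hr' (h j) hne)).1 rfl
      have hne : h j + 1 ≠ h j' := fun hc =>
        (toroidalGrid_adj_fst (n := n) hm2 (h j) j).ne (Prod.ext (hEq.trans hc.symm) rfl)
      exact ((hpiece j hj i hi _ (hr' (h j + 1) hne)).2 rfl).symm
    obtain ⟨i, x, hx, y, hy, z, hz, hxy, hxz, hyz, hxi, hyi, hzi⟩ := exists_row_three_ne hm hJ h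
    obtain ⟨a, b, -, hab⟩ := hpair i
    have hnot : ∀ j ∈ J, h j ≠ i → j ≠ a ∧ j ≠ b := fun j hj hji =>
      not_or.1 fun hc => hji ((hh j hj i).1 ((hab j).2 hc)).symm
    have hside : ∀ j ∈ J, ∀ j' ∈ J, h j ≠ i → h j' ≠ i → j ≠ j' →
        ¬ ((j - a).val < (b - a).val ↔ (j' - a).val < (b - a).val) := by
      intro j hj j' hj' hji hji' hne hiff
      refine hne (hsep j hj j' hj' i hji.symm hji'.symm ?_)
      refine reachIn_cyclic_of_pair (A := Sᶜ) (f := fun z => (i, z))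
        (fun z => toroidalGrid_adj_snd hn2 i z) (fun z hza hzb hc => ?_) (hnot j hj hji).1
        (hnot j hj hji).2 (hnot j' hj' hji').1 (hnot j' hj' hji').2 hiff
      exact ((hab z).1 hc).elim hza hzb
    have h1 := hside x hx y hy hxi hyi hxy
    have h2 := hside x hx z hz hxi hzi hxz
    have h3 := hside y hy z hz hyi hzi hyz
    tauto

end LowerBound

section UpperBound

theorem isTree_hasse_nat : (hasse ℕ).IsTree := by
  refine ⟨⟨hasse_preconnected_of_succ ℕ⟩, ?_⟩
  rw [isAcyclic_iff_forall_isBridge]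
  have key : ∀ k, (hasse ℕ).IsBridge s(k, k + 1) := by
    intro k
    rw [isBridge_iff]
    rw [reachable_iff_reflTransGen]
    intro h
    have : ∀ x, Relation.ReflTransGen ((hasse ℕ).deleteEdges {s(k, k + 1)}).Adj k x → x ≤ k := by
      intro x hx
      induction hx with
      | refl => exact le_rfl
      | tail _ h ih =>
        simp only [deleteEdges_adj, hasse_adj, Nat.covBy_iff_add_one_eq, Set.mem_singleton_iff,
          Sym2.eq_iff] at h
        omega
    have := this _ h
    omega
  intro e he
  induction e with
  | _ a b =>
    simp only [mem_edgeSet, hasse_adj, Nat.covBy_iff_add_one_eq] at he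
    rcases he with rfl | rfl
    · exact key a
    · rw [Sym2.eq_swap]
      exact key b

theorem hasse_nat_induce_connected {A : Set ℕ} (hne : A.Nonempty) (hA : A.OrdConnected) :
    ((hasse ℕ).induce A).Connected := by
  have key : ∀ (x : ℕ) (hx : x ∈ A) (d : ℕ) (hd : x + d ∈ A),
      ((hasse ℕ).induce A).Reachable ⟨x, hx⟩ ⟨x + d, hd⟩ := by
    intro x hx d
    induction d with
    | zero => exact fun _ => .refl _
    | succ d ih =>
      intro hd
      have hd' : x + d ∈ A := hA.out hx hd ⟨by omega, by omega⟩
      refine (ih hd').trans (Adj.reachable ?_)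
      simp [hasse_adj, Nat.covBy_iff_add_one_eq, add_assoc]
  have : Nonempty A := hne.to_subtype
  refine ⟨fun ⟨x, hx⟩ ⟨y, hy⟩ => ?_⟩
  rcases le_total x y with h | h
  · obtain ⟨d, rfl⟩ := Nat.exists_eq_add_of_le h
    exact key x hx d hy
  · obtain ⟨d, rfl⟩ := Nat.exists_eq_add_of_le h
    exact (key y hy d hx).symm

theorem val_of_cycleGraph_adj {k : ℕ} {u v : Fin k} (h : (cycleGraph k).Adj u v) :
    u.val + 1 = v.val ∨ v.val + 1 = u.val ∨ u.val = 0 ∨ v.val = 0 := by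
  have key : ∀ u v : Fin k, (u - v).val = 1 → v.val + 1 = u.val ∨ u.val = 0 := by
    intro u v h
    rcases le_or_gt v u with hle | hlt
    · rw [Fin.sub_val_of_le hle] at h
      omega
    · rw [Fin.val_sub, Nat.mod_eq_of_lt (by omega)] at h
      omega
  rcases cycleGraph_adj'.1 h with h | h
  · have := key u v h
    omega
  · have := key v u h
    omega

/-- Sweep the torus column by column, keeping column `0` in every bag. -/
def toroidalGridDecomp (m n : ℕ) : TreeDecomp (toroidalGrid m n) where
  ι := ℕ
  tree := hasse ℕ
  isTree := isTree_hasse_nat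
  bag t := {v | v.2.val = 0 ∨ t ≤ v.2.val * m + v.1.val ∧ v.2.val * m + v.1.val ≤ t + m}
  bag_cover v := ⟨v.2.val * m + v.1.val, .inr ⟨le_rfl, by omega⟩⟩
  bag_edge := by
    rintro ⟨i, j⟩ ⟨i', j'⟩ h
    have hi := i.isLt
    have hi' := i'.isLt
    rw [toroidalGrid, boxProd_adj] at h
    suffices hs : j.val = 0 ∨ j'.val = 0 ∨ j.val * m + i.val ≤ j'.val * m + i'.val + m ∧
        j'.val * m + i'.val ≤ j.val * m + i.val + m by
      rcases hs with hs | hs | ⟨h₁, h₂⟩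
      · exact ⟨j'.val * m + i'.val, .inl hs, .inr ⟨le_rfl, Nat.le_add_right _ _⟩⟩
      · exact ⟨j.val * m + i.val, .inr ⟨le_rfl, Nat.le_add_right _ _⟩, .inl hs⟩
      · rcases le_total (j.val * m + i.val) (j'.val * m + i'.val) with hle | hle
        · exact ⟨_, .inr ⟨le_rfl, Nat.le_add_right _ _⟩, .inr ⟨hle, h₂⟩⟩
        · exact ⟨_, .inr ⟨hle, h₁⟩, .inr ⟨le_rfl, Nat.le_add_right _ _⟩⟩
    rcases h with ⟨-, hj⟩ | ⟨hj, hi⟩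
    · obtain rfl : j = j' := hj
      omega
    · obtain rfl : i = i' := hi
      rcases val_of_cycleGraph_adj hj with h | h | h | h <;> dsimp only at h
      · rw [← h, add_mul]
        omega
      · rw [← h, add_mul]
        omega
      · exact .inl h
      · exact .inr (.inl h)
  bag_conn v := by
    by_cases hv : v.2.val = 0
    · refine hasse_nat_induce_connected ⟨0, .inl hv⟩ ⟨fun _ _ _ _ _ _ => .inl hv⟩
    · refine hasse_nat_induce_connected ⟨v.2.val * m + v.1.val, .inr ⟨le_rfl, by omega⟩⟩ ⟨?_⟩
      rintro x (hx | hx) y (hy | hy) z ⟨hz, hz'⟩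
      any_goals contradiction
      exact .inr ⟨by omega, by omega⟩

theorem toroidalGridDecomp_ncard_le (m n : ℕ) (t : ℕ) :
    ((toroidalGridDecomp m n).bag t).ncard ≤ 2 * m + 1 := by
  have hA : {v : Fin m × Fin n | v.2.val = 0}.ncard ≤ m := by
    have := Set.ncard_le_ncard_of_injOn (s := {v : Fin m × Fin n | v.2.val = 0}) (t := Set.univ)
      Prod.fst (fun _ _ => Set.mem_univ _)
      fun v hv w hw h => Prod.ext h (Fin.ext (hv.trans (Eq.symm hw)))
    simpa [Set.ncard_univ] using this
  have hB : {v : Fin m × Fin n | t ≤ v.2.val * m + v.1.val ∧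
      v.2.val * m + v.1.val ≤ t + m}.ncard ≤ m + 1 := by
    have := Set.ncard_le_ncard_of_injOn (s := {v : Fin m × Fin n | t ≤ v.2.val * m + v.1.val ∧
      v.2.val * m + v.1.val ≤ t + m}) (t := Set.Icc t (t + m))
      (fun v => v.2.val * m + v.1.val) (fun _ hv => hv)
      (by
        rintro ⟨i, j⟩ - ⟨i', j'⟩ - h
        have hdiv : ∀ (i : Fin m) (j : Fin n),
            (j.val * m + i.val) / m = j.val ∧ (j.val * m + i.val) % m = i.val := by
          intro i j
          rw [mul_comm, Nat.mul_add_div i.pos, Nat.mul_add_mod, Nat.div_eq_of_lt i.isLt,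
            Nat.mod_eq_of_lt i.isLt]
          simp
        simp only at h
        have h1 := hdiv i j
        rw [h, (hdiv i' j').1, (hdiv i' j').2] at h1
        exact Prod.ext (Fin.ext h1.2.symm) (Fin.ext h1.1.symm))
    refine this.trans (le_of_eq ?_)
    rw [Set.ncard_eq_toFinset_card', Set.toFinset_Icc, Nat.card_Icc]
    omega
  have hU := Set.ncard_union_le {v : Fin m × Fin n | v.2.val = 0}
    {v | t ≤ v.2.val * m + v.1.val ∧ v.2.val * m + v.1.val ≤ t + m}
  have hbag : (toroidalGridDecomp m n).bag t = {v : Fin m × Fin n | v.2.val = 0} ∪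
    {v | t ≤ v.2.val * m + v.1.val ∧ v.2.val * m + v.1.val ≤ t + m} := rfl
  rw [hbag]
  omega

end UpperBound

section Iso

variable {V W : Type*} {G : SimpleGraph V} {H : SimpleGraph W}

/-- Transport of a tree decomposition along a graph isomorphism. -/
def TreeDecomp.map (e : G ≃g H) (D : TreeDecomp G) : TreeDecomp H where
  ι := D.ι
  tree := D.tree
  isTree := D.isTree
  bag t := e.symm ⁻¹' D.bag t
  bag_cover v := D.bag_cover (e.symm v)
  bag_edge _ _ h := D.bag_edge (e.symm.map_adj_iff.2 h)
  bag_conn v := D.bag_conn (e.symm v)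

theorem setOf_width_subset_of_iso (e : G ≃g H) :
    {k : ℕ | ∃ D : TreeDecomp G, ∀ t, (D.bag t).ncard ≤ k + 1} ⊆
    {k : ℕ | ∃ D : TreeDecomp H, ∀ t, (D.bag t).ncard ≤ k + 1} := by
  rintro k ⟨D, hD⟩
  refine ⟨D.map e, fun t => ?_⟩
  refine le_trans (le_of_eq ?_) (hD t)
  exact Set.ncard_preimage_of_injective_subset_range e.symm.injective
    (by simp [e.symm.surjective.range_eq])

theorem treewidth_congr (e : G ≃g H) : treewidth G = treewidth H :=
  congrArg sInf ((setOf_width_subset_of_iso e).antisymm (setOf_width_subset_of_iso e.symm))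

end Iso

theorem toroidalGrid_treewidth_of_add_two_le {m n : ℕ} (hm : 3 ≤ m) (hmn : m + 2 ≤ n) :
    treewidth (toroidalGrid m n) = 2 * m := by
  have : NeZero m := ⟨by omega⟩
  have : NeZero n := ⟨by omega⟩
  refine le_antisymm (Nat.sInf_le ⟨toroidalGridDecomp m n, toroidalGridDecomp_ncard_le m n⟩)
    (le_csInf ⟨_, toroidalGridDecomp m n, toroidalGridDecomp_ncard_le m n⟩ ?_)
  rintro k ⟨D, hD⟩
  obtain ⟨t, ht⟩ := exists_bag_ncard_gt hm hmn D
  have := hD t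
  omega

/-- If `m, n ≥ 3` and `|m − n| ≥ 2`, the treewidth of the toroidal grid `T_{m,n}` equals
`2 · min {m, n}`. -/
theorem toroidalGrid_treewidth (m n : ℕ) (hm : 3 ≤ m) (hn : 3 ≤ n)
    (hmn : 2 ≤ ((m : ℤ) - (n : ℤ)).natAbs) :
    treewidth (toroidalGrid m n) = 2 * min m n := by
  rcases le_total m n with h | h
  · rw [min_eq_left h]
    exact toroidalGrid_treewidth_of_add_two_le hm (by omega)
  · rw [min_eq_right h, ← toroidalGrid_treewidth_of_add_two_le hn (by omega : n + 2 ≤ m)]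
    exact treewidth_congr (boxProdComm _ _)
end

section
/- If m ≥ 3 and n ≥ 1 with m < 2n, then the stacked prism graph Y_{m,n} admits a strict bramble of order m; in particular sbn(Y_{m,n}) ≥ m. -/
open SimpleGraph

namespace SimpleGraph

variable {V W : Type*} {G : SimpleGraph V} {H : SimpleGraph W}

lemma Connected.induce_image {s : Set V} (hs : (G.induce s).Connected) (f : G →g H) :
    (H.induce (f '' s)).Connected :=
  hs.map (induceHom f (Set.mapsTo_image f s)) (Set.surjective_mapsTo_image_restrict f s)

lemma Connected.induce_range (hG : G.Connected) (f : G →g H) :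
    (H.induce (Set.range f)).Connected := by
  rw [← Set.image_univ]
  exact ((induceUnivIso G).connected_iff.mpr hG).induce_image f

/-- A cycle remains connected when at most one vertex is deleted. -/
lemma cycleGraph_induce_compl_connected {k : ℕ} {T : Set (Fin (k + 2))} (hT : T.Subsingleton) :
    ((cycleGraph (k + 2)).induce Tᶜ).Connected := by
  obtain rfl | ⟨v, rfl⟩ := hT.eq_empty_or_singleton
  · rw [Set.compl_empty]
    exact (induceUnivIso _).connected_iff.mpr cycleGraph_connected
  · let f : pathGraph (k + 1) →g cycleGraph (k + 2) :=
      { toFun := fun i => v + i.succ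
        map_rel' := by
          intro a b h
          have key : ∀ a b : Fin (k + 1), a.val + 1 = b.val → b.succ - a.succ = 1 := by
            intro a b h
            rw [sub_eq_iff_eq_add']
            ext
            simp only [Fin.val_succ, Fin.val_add, Fin.val_one]
            rw [Nat.mod_eq_of_lt (by omega)]
            omega
          rw [cycleGraph_adj, add_sub_add_left_eq_sub, add_sub_add_left_eq_sub]
          exact (pathGraph_adj.mp h).symm.imp (key b a) (key a b) }
    have hf : Set.range f = {v}ᶜ := by
      ext w
      constructor
      · rintro ⟨i, rfl⟩ h
        exact Fin.succ_ne_zero i (add_eq_left.mp h)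
      · intro hw
        obtain ⟨i, hi⟩ := Fin.exists_succ_eq.mpr (sub_ne_zero.mpr hw : w - v ≠ 0)
        exact ⟨i, by simp [f, hi]⟩
    rw [← hf]
    exact (pathGraph_connected k).induce_range f

/-- In a box product, a nonempty union of full rows together with two connected pieces of columns
that cross all of these rows is connected. -/
lemma boxProd_induce_rows_union_columns_connected (hH : H.Connected)
    {F K₁ K₂ : Set V} (hF : F.Nonempty) (h₁ : F ⊆ K₁) (h₂ : F ⊆ K₂)
    (hK₁ : (G.induce K₁).Connected) (hK₂ : (G.induce K₂).Connected) (j₁ j₂ : W) :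
    ((G □ H).induce {p | p.1 ∈ F ∨ p.1 ∈ K₁ ∧ p.2 = j₁ ∨ p.1 ∈ K₂ ∧ p.2 = j₂}).Connected := by
  let col (K : Set V) (j : W) : Set (V × W) := (G.boxProdLeft H j).toHom '' K
  let row (r : V) : Set (V × W) := Set.range (G.boxProdRight H r).toHom
  let cross (r : V) : Set (V × W) := row r ∪ col K₁ j₁ ∪ col K₂ j₂
  have hcross : ∀ r ∈ F, ((G □ H).induce (cross r)).Connected := fun r hr =>
    induce_union_connected
      (induce_union_connected (hH.induce_range _).preconnected
        (hK₁.induce_image _).preconnected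
        ⟨(r, j₁), ⟨j₁, rfl⟩, r, h₁ hr, rfl⟩).preconnected
      (hK₂.induce_image _).preconnected
      ⟨(r, j₂), Or.inl ⟨j₂, rfl⟩, r, h₂ hr, rfl⟩
  have hunion : {p : V × W | p.1 ∈ F ∨ p.1 ∈ K₁ ∧ p.2 = j₁ ∨ p.1 ∈ K₂ ∧ p.2 = j₂} =
      ⋃₀ (cross '' F) := by
    obtain ⟨r, hr⟩ := hF
    ext ⟨i, j⟩
    simp only [Set.mem_ofPred_eq, Set.sUnion_image, Set.mem_iUnion, exists_prop]
    constructor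
    · rintro (hi | ⟨hi, rfl⟩ | ⟨hi, rfl⟩)
      · exact ⟨i, hi, Or.inl (Or.inl ⟨j, rfl⟩)⟩
      · exact ⟨r, hr, Or.inl (Or.inr ⟨i, hi, rfl⟩)⟩
      · exact ⟨r, hr, Or.inr ⟨i, hi, rfl⟩⟩
    · rintro ⟨s, hs, (⟨j', h⟩ | ⟨i', hi', h⟩) | ⟨i', hi', h⟩⟩ <;> cases h
      · exact Or.inl hs
      · exact Or.inr (Or.inl ⟨hi', rfl⟩)
      · exact Or.inr (Or.inr ⟨hi', rfl⟩)
  rw [hunion]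
  refine induce_sUnion_connected_of_pairwise_not_disjoint (hF.image _) ?_ ?_
  · rintro _ _ ⟨r, hr, rfl⟩ ⟨s, hs, rfl⟩
    exact ⟨(r, j₁), Or.inl (Or.inr ⟨r, h₁ hr, rfl⟩), Or.inl (Or.inr ⟨r, h₁ hr, rfl⟩)⟩
  · rintro _ ⟨r, hr, rfl⟩
    exact hcross r hr

end SimpleGraph

/-- The rows `{i} × β` contained in `B`. -/
def fullRows {α β : Type*} (B : Set (α × β)) : Set α := {i | ∀ j, (i, j) ∈ B}

/-- The rows `{i} × β` disjoint from `B`. -/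
def missedRows {α β : Type*} (B : Set (α × β)) : Set α := {i | ∀ j, (i, j) ∉ B}

/-- The connected vertex sets that contain more rows than they miss. -/
def rowBramble {α β : Type*} (G : SimpleGraph (α × β)) : Set (Set (α × β)) :=
  {B | (G.induce B).Connected ∧ (missedRows B).ncard < (fullRows B).ncard}

lemma isStrictBramble_of_inter_nonempty {V : Type*} {G : SimpleGraph V} {ℬ : Set (Set V)}
    (hconn : ∀ B ∈ ℬ, (G.induce B).Connected)
    (hinter : ∀ A ∈ ℬ, ∀ B ∈ ℬ, (A ∩ B).Nonempty) : IsStrictBramble G ℬ :=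
  ⟨⟨hconn, fun A hA B hB => induce_union_connected (hconn A hA).preconnected
    (hconn B hB).preconnected (hinter A hA B hB)⟩, hinter⟩

lemma rowBramble_isStrictBramble {α β : Type*} [Finite α] (G : SimpleGraph (α × β)) :
    IsStrictBramble G (rowBramble G) := by
  refine isStrictBramble_of_inter_nonempty (fun B hB => hB.1) fun A hA B hB => ?_
  by_contra hAB
  have hdisj : ∀ p, p ∈ A → p ∉ B := fun p hpA hpB => hAB ⟨p, hpA, hpB⟩
  have h₁ : (fullRows A).ncard ≤ (missedRows B).ncard :=
    Set.ncard_le_ncard fun i hi j => hdisj _ (hi j)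
  have h₂ : (fullRows B).ncard ≤ (missedRows A).ncard :=
    Set.ncard_le_ncard fun i hi j hA => hdisj _ hA (hi j)
  exact absurd hA.2 (by have := hB.2; omega)

lemma isHittingSet_column_rowBramble {α β : Type*} (G : SimpleGraph (α × β)) (j : β) :
    IsHittingSet (rowBramble G) (Set.range fun i : α => (i, j)) := by
  intro B hB
  obtain ⟨i, hi⟩ := Set.nonempty_of_ncard_ne_zero (Nat.ne_zero_of_lt hB.2)
  exact ⟨(i, j), ⟨i, rfl⟩, hi j⟩

lemma le_brambleOrder {V : Type*} {G : SimpleGraph V} {ℬ : Set (Set V)} (hℬ : IsBramble G ℬ)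
    {k : ℕ} (hk : ∀ S, IsHittingSet ℬ S → k ≤ S.ncard) : k ≤ brambleOrder ℬ := by
  refine le_csInf ⟨_, Set.univ, fun B hB => ?_, rfl⟩ ?_
  · rw [Set.univ_inter]
    exact Set.nonempty_coe_sort.mp (hℬ.conn B hB).nonempty
  · rintro _ ⟨S, hS, rfl⟩
    exact hk S hS

lemma brambleOrder_le_strictBrambleNumber {V : Type*} [Finite V] {G : SimpleGraph V}
    {ℬ : Set (Set V)} (hℬ : IsStrictBramble G ℬ) : brambleOrder ℬ ≤ strictBrambleNumber G := by
  refine le_csSup ⟨Nat.card V, ?_⟩ ⟨ℬ, hℬ, rfl⟩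
  rintro _ ⟨𝒜, h𝒜, rfl⟩
  rw [← Set.ncard_univ]
  refine Nat.sInf_le ⟨Set.univ, fun B hB => ?_, rfl⟩
  rw [Set.univ_inter]
  exact Set.nonempty_coe_sort.mp (h𝒜.1.conn B hB).nonempty

/-- A set of at most `2 (|β| - 1)` points leaves some column untouched, or meets two distinct
columns in at most one point each. -/
lemma exists_sparse_columns {α β : Type*} [Fintype β] [Nonempty β] [DecidableEq β]
    (S : Finset (α × β)) (hS : S.card + 1 < 2 * Fintype.card β) :
    ∃ j₁ j₂, (S.filter (·.2 = j₁)).card ≤ 1 ∧ (S.filter (·.2 = j₂)).card ≤ 1 ∧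
      (j₁ = j₂ → S.filter (·.2 = j₁) = ∅) := by
  by_contra! hcon
  have hpos : ∀ j, 1 ≤ (S.filter (·.2 = j)).card := by
    intro j
    by_contra! hj
    exact (hcon j j (by omega) (by omega)).2.ne_empty (Finset.card_eq_zero.mp (by omega))
  have huniq : ∀ j₁ j₂, (S.filter (·.2 = j₁)).card ≤ 1 → (S.filter (·.2 = j₂)).card ≤ 1 →
      j₁ = j₂ := fun j₁ j₂ h₁ h₂ => (hcon j₁ j₂ h₁ h₂).1
  obtain ⟨j₀, hj₀⟩ : ∃ j₀, ∀ j ≠ j₀, 2 ≤ (S.filter (·.2 = j)).card := by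
    by_cases h : ∃ j₀, (S.filter (·.2 = j₀)).card ≤ 1
    · obtain ⟨j₀, hj₀⟩ := h
      exact ⟨j₀, fun j hj => by
        by_contra! hlt
        exact hj (huniq j j₀ (by omega) hj₀)⟩
    · push Not at h
      exact ⟨Classical.arbitrary β, fun j _ => h j⟩
  have hsum : S.card = ∑ j, (S.filter (·.2 = j)).card :=
    Finset.card_eq_sum_card_fiberwise fun p _ => Finset.mem_coe.mpr (Finset.mem_univ p.2)
  rw [← Finset.add_sum_erase _ _ (Finset.mem_univ j₀)] at hsum
  have hrest : (Finset.univ.erase j₀).card * 2 ≤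
      ∑ j ∈ Finset.univ.erase j₀, (S.filter (·.2 = j)).card :=
    Finset.card_nsmul_le_sum _ _ _ fun j hj => hj₀ j (Finset.ne_of_mem_erase hj)
  rw [Finset.card_erase_of_mem (Finset.mem_univ j₀), Finset.card_univ] at hrest
  have := hpos j₀
  omega

/-- A set with fewer points than there are rows avoids more rows than it meets in two
prescribed distinct columns simultaneously. -/
lemma card_doubly_hit_rows_lt {α β : Type*} [Fintype α] [DecidableEq α] [DecidableEq β]
    (S : Finset (α × β)) [DecidablePred fun i => ∀ j, (i, j) ∉ S]
    (hS : S.card < Fintype.card α) (j₁ j₂ : β) (hj : j₁ = j₂ → S.filter (·.2 = j₁) = ∅) :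
    (Finset.univ.filter fun i => (i, j₁) ∈ S ∧ (i, j₂) ∈ S).card <
      (Finset.univ.filter fun i => ∀ j, (i, j) ∉ S).card := by
  have hsum : S.card = ∑ i, (S.filter (·.1 = i)).card :=
    Finset.card_eq_sum_card_fiberwise fun p _ => Finset.mem_coe.mpr (Finset.mem_univ p.1)
  have hrow : ∀ i, 1 + (if (i, j₁) ∈ S ∧ (i, j₂) ∈ S then 1 else 0) ≤
      (S.filter (·.1 = i)).card + (if ∀ j, (i, j) ∉ S then 1 else 0) := by
    intro i
    by_cases hfree : ∀ j, (i, j) ∉ S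
    · simp [hfree]
    by_cases hd : (i, j₁) ∈ S ∧ (i, j₂) ∈ S
    · have hne : j₁ ≠ j₂ := fun h => by
        have : (i, j₁) ∈ S.filter (·.2 = j₁) := by simp [hd.1]
        simp [hj h] at this
      have : 1 < (S.filter (·.1 = i)).card :=
        Finset.one_lt_card.mpr ⟨(i, j₁), by simp [hd.1], (i, j₂), by simp [hd.2], by simp [hne]⟩
      simp only [hd, hfree, and_self, if_true, if_false]
      omega
    · push Not at hfree
      obtain ⟨j, hjS⟩ := hfree
      have : 0 < (S.filter (·.1 = i)).card := Finset.card_pos.mpr ⟨(i, j), by simp [hjS]⟩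
      simp only [hd, if_false]
      omega
  have := Finset.sum_le_sum fun i (_ : i ∈ Finset.univ) => hrow i
  simp only [Finset.sum_add_distrib, ← Finset.card_filter, ← hsum, Finset.sum_const,
    Finset.card_univ, smul_eq_mul, mul_one] at this
  omega

lemma exists_mem_rowBramble_disjoint {m n : ℕ} (hm : 2 ≤ m) (hmn : m < 2 * n)
    (S : Finset (Fin m × Fin n)) (hS : S.card < m) :
    ∃ B ∈ rowBramble (stackedPrism m n), Disjoint (S : Set (Fin m × Fin n)) B := by
  obtain ⟨k, rfl⟩ := Nat.exists_eq_add_of_le' hm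
  obtain ⟨l, rfl⟩ := Nat.exists_eq_add_of_le' (by omega : 1 ≤ n)
  obtain ⟨j₁, j₂, h₁, h₂, hj⟩ := exists_sparse_columns S (by rw [Fintype.card_fin]; omega)
  have hlt := card_doubly_hit_rows_lt S (by rwa [Fintype.card_fin]) j₁ j₂ hj
  have hcol : ∀ j, (S.filter (·.2 = j)).card ≤ 1 →
      ((cycleGraph (k + 2)).induce {i | (i, j) ∈ S}ᶜ).Connected := fun j h =>
    cycleGraph_induce_compl_connected fun a ha b hb => congrArg Prod.fst <|
      Finset.card_le_one.mp h (a, j) (Finset.mem_filter.mpr ⟨ha, rfl⟩)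
        (b, j) (Finset.mem_filter.mpr ⟨hb, rfl⟩)
  let F : Set (Fin (k + 2)) := {i | ∀ j, (i, j) ∉ S}
  have hF : F.Nonempty := by
    obtain ⟨i, hi⟩ := Finset.card_pos.mp (Nat.zero_lt_of_lt hlt)
    exact ⟨i, (Finset.mem_filter.mp hi).2⟩
  refine ⟨_, ⟨boxProd_induce_rows_union_columns_connected (pathGraph_connected l) hF
    (fun i hi => hi j₁) (fun i hi => hi j₂) (hcol j₁ h₁) (hcol j₂ h₂) j₁ j₂, ?_⟩, ?_⟩
  · rw [← Set.ncard_coe_finset, ← Set.ncard_coe_finset] at hlt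
    refine (Set.ncard_le_ncard fun i hi => ?_).trans_lt
      (hlt.trans_le (Set.ncard_le_ncard fun i hi => ?_))
    · rw [Finset.mem_coe, Finset.mem_filter]
      refine ⟨Finset.mem_univ i, ?_, ?_⟩
      · by_contra h
        exact hi j₁ (Or.inr (Or.inl ⟨h, rfl⟩))
      · by_contra h
        exact hi j₂ (Or.inr (Or.inr ⟨h, rfl⟩))
    · exact fun j => Or.inl (Finset.mem_filter.mp hi).2
  · rw [Set.disjoint_left]
    rintro ⟨i, j⟩ hp (h | ⟨h, hjj⟩ | ⟨h, hjj⟩)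
    · exact h j hp
    · exact h (hjj ▸ hp)
    · exact h (hjj ▸ hp)

lemma brambleOrder_rowBramble_stackedPrism {m n : ℕ} (hm : 2 ≤ m) (hmn : m < 2 * n) :
    brambleOrder (rowBramble (stackedPrism m n)) = m := by
  refine le_antisymm
    (Nat.sInf_le ⟨_, isHittingSet_column_rowBramble _ ⟨0, by omega⟩, ?_⟩)
    (le_brambleOrder (rowBramble_isStrictBramble _).1 fun S hS => ?_)
  · rw [← Set.image_univ, Set.ncard_image_of_injective _ (Prod.mk_left_injective _),
      Set.ncard_univ, Nat.card_fin]
  · by_contra! hlt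
    have hfin := S.toFinite
    obtain ⟨B, hB, hdisj⟩ := exists_mem_rowBramble_disjoint hm hmn hfin.toFinset
      (by rwa [← Set.ncard_eq_toFinset_card S hfin])
    rw [hfin.coe_toFinset] at hdisj
    exact Set.not_disjoint_iff_nonempty_inter.mpr (hS B hB) hdisj

/-- If `m < 2n`, the stacked prism `Y_{m,n}` admits a strict bramble of order `m`;
in particular `sbn(Y_{m,n}) ≥ m`. -/
theorem stackedPrism_strictBramble_of_lt_two_n (m n : ℕ) (hm : 3 ≤ m) (hn : 1 ≤ n)
    (hmn : m < 2 * n) :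
    (∃ ℬ : Set (Set (Fin m × Fin n)),
        IsStrictBramble (stackedPrism m n) ℬ ∧ brambleOrder ℬ = m) ∧
      m ≤ strictBrambleNumber (stackedPrism m n) := by
  have hstrict := rowBramble_isStrictBramble (stackedPrism m n)
  have horder := brambleOrder_rowBramble_stackedPrism (by omega : 2 ≤ m) hmn
  exact ⟨⟨_, hstrict, horder⟩, horder.symm.trans_le (brambleOrder_le_strictBrambleNumber hstrict)⟩
end
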